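/- If F is a face of a convex subset C of a real vector space, then F equals the intersection of its affine hull with C: F = aff(F) ∩ C. -/

import Mathlib

open Set

variable {V : Type*} [AddCommGroup V] [Module ℝ V]

/-- `F` is a face of the convex set `C`. -/
def IsFace (C F : Set V) : Prop :=
  F.Nonempty ∧ Convex ℝ F ∧ F ⊆ C ∧
    ∀ x ∈ C, ∀ y ∈ C, ∀ α : ℝ, 0 < α → α < 1 → α • x + (1 - α) • y ∈ F → x ∈ F ∧ y ∈ F

/-- The direction of the affine hull of a nonempty convex set consists of the positive multiples
of differences of its points. -/
theorem Convex.exists_pos_smul_sub_of_mem_vectorSpan {F : Set V} (hF : Convex ℝ F)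
    (hne : F.Nonempty) {v : V} (hv : v ∈ vectorSpan ℝ F) :
    ∃ s : ℝ, 0 < s ∧ ∃ p ∈ F, ∃ q ∈ F, v = s • (p - q) := by
  induction hv using Submodule.span_induction with
  | mem v hv =>
    obtain ⟨p, hp, q, hq, rfl⟩ := hv
    exact ⟨1, one_pos, p, hp, q, hq, by simp⟩
  | zero =>
    obtain ⟨p, hp⟩ := hne
    exact ⟨1, one_pos, p, hp, p, hp, by simp⟩
  | add v w _ _ hv hw =>
    obtain ⟨s, hs, p, hp, q, hq, rfl⟩ := hv
    obtain ⟨t, ht, p', hp', q', hq', rfl⟩ := hw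
    have hst : s + t ≠ 0 := by positivity
    have hsum : s / (s + t) + t / (s + t) = 1 := by field_simp
    refine ⟨s + t, by positivity, (s / (s + t)) • p + (t / (s + t)) • p',
      hF hp hp' (by positivity) (by positivity) hsum, (s / (s + t)) • q + (t / (s + t)) • q',
      hF hq hq' (by positivity) (by positivity) hsum, ?_⟩
    match_scalars <;> field_simp
  | smul c v _ hv =>
    obtain ⟨s, hs, p, hp, q, hq, rfl⟩ := hv
    rcases lt_trichotomy c 0 with hc | rfl | hc
    · exact ⟨-c * s, mul_pos (neg_pos.2 hc) hs, q, hq, p, hp, by module⟩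
    · exact ⟨1, one_pos, p, hp, p, hp, by simp⟩
    · exact ⟨c * s, mul_pos hc hs, p, hp, q, hq, by module⟩

/-- A face `F` of a convex subset `C` of a real vector space is the
intersection of its affine hull with `C`. -/
theorem face_eq_affineSpan_inter
    (C : Set V) (hC : Convex ℝ C) (F : Set V) (hF : IsFace C F) :
    F = (affineSpan ℝ F : Set V) ∩ C := by
  obtain ⟨hne, hconv, hsub, hface⟩ := hF
  refine Subset.antisymm (subset_inter (subset_affineSpan ℝ F) hsub) ?_
  rintro x ⟨hx, hxC⟩
  obtain ⟨f, hf⟩ := hne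
  have hv : x - f ∈ vectorSpan ℝ F := by
    rw [← direction_affineSpan]
    exact AffineSubspace.vsub_mem_direction hx (subset_affineSpan ℝ F hf)
  obtain ⟨s, hs, p, hp, q, hq, h⟩ := hconv.exists_pos_smul_sub_of_mem_vectorSpan ⟨f, hf⟩ hv
  obtain rfl : x = s • (p - q) + f := sub_eq_iff_eq_add.1 h
  refine (hface _ hxC q (hsub hq) (1 / (1 + s)) (by positivity)
    ((div_lt_one (by positivity)).2 (by linarith)) ?_).1
  have hs' : 1 + s ≠ 0 := by positivity
  convert hconv hf hp (a := 1 / (1 + s)) (b := s / (1 + s)) (by positivity) (by positivity)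
    (by field_simp) using 1
  match_scalars <;> field_simp
  ring
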